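/- Let a : ℕ → ℂ satisfy Σ_n |a(n)| < ∞ and let T ≥ 1. Then ∫_{−T}^{T} |Σ_n a(n) n^{−it}|² dt ≤ C·T² ∫_0^∞ |Σ_{x < n ≤ x e^{1/T}} a(n)|² dx/x for some absolute constant C. -/

import Mathlib

open MeasureTheory FourierTransform SchwartzMap
open scoped ContDiff

lemma gl_plancherel (f : ℝ → ℂ) (h1 : Integrable f) (h2 : MemLp f 2) :
    MemLp (𝓕 f) 2 ∧ ∫ w, ‖𝓕 f w‖ ^ 2 = ∫ u, ‖f u‖ ^ 2 := by
  set F : Lp ℂ 2 (volume : Measure ℝ) := h2.toLp f with hF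
  have hcont : Continuous (𝓕 f) := by
    exact VectorFourier.fourierIntegral_continuous Real.continuous_fourierChar
      (L := innerₗ ℝ) continuous_inner h1
  have key : ∀ᵐ x, (𝓕 F : Lp ℂ 2 (volume : Measure ℝ)) x = 𝓕 f x := by
    apply ae_eq_of_integral_contDiff_smul_eq
    · exact (Lp.memLp _).locallyIntegrable (by norm_num)
    · exact hcont.locallyIntegrable
    intro g hg hgs
    have hg' : ContDiff ℝ ∞ (fun x => (g x : ℂ)) := Complex.ofRealCLM.contDiff.comp hg
    have hgs' : HasCompactSupport (fun x => (g x : ℂ)) := hgs.comp_left (g := fun r : ℝ => (r : ℂ)) (by simp)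
    let G : 𝓢(ℝ, ℂ) := hgs'.toSchwartzMap hg'
    have hG : ∀ x, G x = (g x : ℂ) := fun x => rfl
    have e1 := congrArg (fun φ => φ G) (Lp.fourier_toTemperedDistribution_eq F)
    simp only [TemperedDistribution.fourier_apply, Lp.toTemperedDistribution_apply] at e1
    have e2 : ∫ x, 𝓕 G x • F x = ∫ x, 𝓕 G x • f x := by
      apply integral_congr_ae
      filter_upwards [h2.coeFn_toLp] with x hx
      rw [hF, hx]
    have e3 : ∫ ξ, 𝓕 (G : ℝ → ℂ) ξ • f ξ = ∫ x, G x • 𝓕 f x := by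
      simpa using! VectorFourier.integral_fourierIntegral_smul_eq_flip (L := innerₗ ℝ)
        Real.continuous_fourierChar continuous_inner G.integrable h1
    have : ∫ x, G x • (𝓕 F : Lp ℂ 2 (volume : Measure ℝ)) x = ∫ x, G x • 𝓕 f x := by
      rw [← e1, e2, ← e3, SchwartzMap.fourier_coe]
    simpa [hG] using this
  have hm : MemLp (𝓕 f) 2 := (memLp_congr_ae key).1 (Lp.memLp _)
  refine ⟨hm, ?_⟩
  have n1 : eLpNorm (𝓕 f) 2 = eLpNorm f 2 := by
    have := Lp.norm_fourier_eq F
    rw [Lp.norm_def, Lp.norm_def, ENNReal.toReal_eq_toReal_iff' (Lp.eLpNorm_ne_top _) (Lp.eLpNorm_ne_top _)] at this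
    rw [← eLpNorm_congr_ae key, this, eLpNorm_congr_ae h2.coeFn_toLp]
  have a1 := hm.eLpNorm_eq_integral_rpow_norm (by norm_num) (by norm_num)
  have a2 := h2.eLpNorm_eq_integral_rpow_norm (by norm_num) (by norm_num)
  rw [n1, a2] at a1
  rw [ENNReal.ofReal_eq_ofReal_iff (by positivity) (by positivity)] at a1
  have := Real.rpow_left_injOn (x := (ENNReal.toReal 2)⁻¹) (by norm_num) (by simp; positivity) (by simp; positivity) a1
  simpa using this.symm

/-- one term of the short sum in the variable `u = log x` -/
noncomputable def glTerm (a : ℕ → ℂ) (d : ℝ) (n : ℕ) (u : ℝ) : ℂ :=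
  (Set.Ico (Real.log n - d) (Real.log n)).indicator (fun _ => a n) u

lemma glTerm_eq (a : ℕ → ℂ) (h0 : a 0 = 0) (d : ℝ) (n : ℕ) (u : ℝ) :
    (if Real.exp u < (n : ℝ) ∧ (n : ℝ) ≤ Real.exp u * Real.exp d then a n else 0)
      = glTerm a d n u := by
  unfold glTerm
  rcases Nat.eq_zero_or_pos n with rfl | hn
  · simp [h0]
  have hn' : (0 : ℝ) < n := by exact_mod_cast hn
  rw [Set.indicator_apply]
  refine if_congr ?_ rfl rfl
  rw [← Real.exp_add, ← Real.lt_log_iff_exp_lt hn', ← Real.log_le_iff_le_exp hn', Set.mem_Ico]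
  constructor <;> rintro ⟨h, h'⟩ <;> constructor <;> linarith

lemma glTerm_meas (a : ℕ → ℂ) (d : ℝ) (n : ℕ) : Measurable (glTerm a d n) :=
  measurable_const.indicator measurableSet_Ico

lemma glTerm_norm (a : ℕ → ℂ) (d : ℝ) (n : ℕ) (u : ℝ) : ‖glTerm a d n u‖ ≤ ‖a n‖ :=
  norm_indicator_le_norm_self (fun _ : ℝ => a n) u

lemma glTerm_integrable (a : ℕ → ℂ) (d : ℝ) (n : ℕ) : Integrable (glTerm a d n) :=
  (integrable_indicator_iff measurableSet_Ico).2 (integrableOn_const (by simp))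

lemma glTerm_lintegral (a : ℕ → ℂ) (d : ℝ) (n : ℕ) :
    ∫⁻ u, ‖glTerm a d n u‖ₑ = ‖a n‖ₑ * ENNReal.ofReal d := by
  simp_rw [glTerm, enorm_indicator_eq_indicator_enorm]
  rw [lintegral_indicator measurableSet_Ico]
  simp

lemma gl_sum_fin (a : ℕ → ℂ) (d : ℝ) (ha : Summable (fun n => ‖a n‖)) :
    ∑' n, ∫⁻ u, ‖glTerm a d n u‖ₑ ≠ ⊤ := by
  simp_rw [glTerm_lintegral]
  rw [ENNReal.tsum_mul_right]
  refine ENNReal.mul_ne_top ?_ ENNReal.ofReal_ne_top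
  have := ha.tsum_ofReal_ne_top
  simpa using this

lemma gl_summable (a : ℕ → ℂ) (d : ℝ) (ha : Summable (fun n => ‖a n‖)) (u : ℝ) :
    Summable (fun n => ‖glTerm a d n u‖) :=
  ha.of_nonneg_of_le (fun _ => norm_nonneg _) (fun n => glTerm_norm a d n u)

lemma gl_meas (a : ℕ → ℂ) (d : ℝ) (ha : Summable (fun n => ‖a n‖)) :
    Measurable (fun u => ∑' n, glTerm a d n u) := by
  refine measurable_of_tendsto_metrizable (f := fun N u => ∑ n ∈ Finset.range N, glTerm a d n u)
    (fun N => Finset.measurable_fun_sum _ (fun n _ => glTerm_meas a d n)) ?_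
  rw [tendsto_pi_nhds]
  intro u
  exact (gl_summable a d ha u).of_norm.hasSum.tendsto_sum_nat

lemma gl_integrable (a : ℕ → ℂ) (d : ℝ) (ha : Summable (fun n => ‖a n‖)) :
    Integrable (fun u => ∑' n, glTerm a d n u) := by
  refine ⟨(gl_meas a d ha).aestronglyMeasurable, ?_⟩
  refine lt_of_le_of_lt (lintegral_mono fun u => enorm_tsum_le_tsum_enorm) ?_
  rw [lintegral_tsum (fun n => (glTerm_meas a d n).enorm.aemeasurable)]
  exact lt_top_iff_ne_top.2 (gl_sum_fin a d ha)

lemma gl_bound (a : ℕ → ℂ) (d : ℝ) (ha : Summable (fun n => ‖a n‖)) (u : ℝ) :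
    ‖∑' n, glTerm a d n u‖ ≤ ∑' n, ‖a n‖ :=
  (norm_tsum_le_tsum_norm (gl_summable a d ha u)).trans
    ((gl_summable a d ha u).tsum_le_tsum (fun n => glTerm_norm a d n u) ha)

lemma gl_memLp (a : ℕ → ℂ) (d : ℝ) (ha : Summable (fun n => ‖a n‖)) :
    MemLp (fun u => ∑' n, glTerm a d n u) 2 := by
  rw [memLp_two_iff_integrable_sq_norm (gl_meas a d ha).aestronglyMeasurable]
  simp_rw [sq]
  refine (gl_integrable a d ha).norm.bdd_mul (c := ∑' n, ‖a n‖) (gl_meas a d ha).norm.aestronglyMeasurable ?_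
  filter_upwards with u
  simpa using gl_bound a d ha u

lemma gl_fourier_term (a : ℕ → ℂ) (h0 : a 0 = 0) (d : ℝ) (n : ℕ) (t : ℝ) :
    ∫ u, Complex.exp (-(t * u : ℝ) * Complex.I) * glTerm a d n u
      = (a n * (n : ℂ) ^ (-(t : ℂ) * Complex.I))
        * ∫ v in Set.Ico (-d) 0, Complex.exp (-(t * v : ℝ) * Complex.I) := by
  rcases Nat.eq_zero_or_pos n with rfl | hn
  · simp [h0, glTerm]
  have hn' : (n : ℂ) ≠ 0 := by exact_mod_cast hn.ne'
  rw [← integral_add_right_eq_self _ (Real.log n), ← integral_indicator measurableSet_Ico,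
    ← integral_const_mul]
  congr 1 with v
  have : (v + Real.log n ∈ Set.Ico (Real.log n - d) (Real.log n)) ↔ v ∈ Set.Ico (-d) 0 := by
    simp only [Set.mem_Ico]
    constructor <;> rintro ⟨h, h'⟩ <;> constructor <;> linarith
  by_cases hv : v ∈ Set.Ico (-d) 0
  · rw [glTerm, Set.indicator_of_mem (this.2 hv), Set.indicator_of_mem hv,
      Complex.cpow_def_of_ne_zero hn', mul_comm, mul_assoc, ← Complex.exp_add, 
      ← Complex.ofReal_natCast, ← Complex.ofReal_log (by positivity)]
    congr 2
    push_cast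
    ring
  · rw [glTerm, Set.indicator_of_notMem (mt this.1 hv), Set.indicator_of_notMem hv]
    simp

lemma gl_fourier (a : ℕ → ℂ) (h0 : a 0 = 0) (d : ℝ) (ha : Summable (fun n => ‖a n‖)) (t : ℝ) :
    𝓕 (fun u => ∑' n, glTerm a d n u) (t / (2 * Real.pi)) =
      (∑' n : ℕ, a n * (n : ℂ) ^ (-(t : ℂ) * Complex.I))
        * ∫ v in Set.Ico (-d) 0, Complex.exp (-(t * v : ℝ) * Complex.I) := by
  rw [Real.fourier_real_eq_integral_exp_smul, ← tsum_mul_right]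
  simp_rw [← gl_fourier_term a h0 d _ t]
  have hE : ∀ u : ℝ, ‖Complex.exp (-(t * u : ℝ) * Complex.I)‖ₑ = 1 := by
    intro u
    rw [← ofReal_norm, ← Complex.ofReal_neg, Complex.norm_exp_ofReal_mul_I]
    simp
  have hEm : Measurable fun u : ℝ => Complex.exp (-(t * u : ℝ) * Complex.I) := by fun_prop
  rw [← integral_tsum]
  · congr 1 with u
    rw [tsum_mul_left, smul_eq_mul]
    congr 3
    push_cast
    have : (Real.pi : ℂ) ≠ 0 := by exact_mod_cast Real.pi_ne_zero
    field_simp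
  · exact fun n => (hEm.mul (glTerm_meas a d n)).aestronglyMeasurable
  · simp_rw [enorm_mul, hE, one_mul]
    exact gl_sum_fin a d ha

lemma gl_kernel (T t : ℝ) (hT : 1 ≤ T) (ht : t ∈ Set.Icc (-T) T) :
    1 / (2 * T) ≤ ‖∫ v in Set.Ico (-(1 / T)) 0, Complex.exp (-(t * v : ℝ) * Complex.I)‖ := by
  have hT0 : 0 < T := by linarith
  have hI : IntegrableOn (fun v : ℝ => Complex.exp (-(t * v : ℝ) * Complex.I)) (Set.Ico (-(1 / T)) 0) := by
    refine IntegrableOn.mono_set (t := Set.Icc (-(1 / T)) 0) ?_ Set.Ico_subset_Icc_self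
    exact Continuous.integrableOn_Icc (by fun_prop)
  refine le_trans ?_ (Complex.re_le_norm _)
  have hre : (∫ v in Set.Ico (-(1 / T)) 0, Complex.exp (-(t * v : ℝ) * Complex.I)).re
      = ∫ v in Set.Ico (-(1 / T)) 0, (Complex.exp (-(t * v : ℝ) * Complex.I)).re :=
    (integral_re hI).symm
  rw [hre]
  have hc : ∫ v in Set.Ico (-(1 / T)) 0, (1 / 2 : ℝ) = 1 / (2 * T) := by
    simp [hT0.le]
  rw [← hc]
  refine setIntegral_mono_on (integrableOn_const (by simp)) hI.re measurableSet_Ico ?_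
  intro v hv
  have h1 : |t * v| ≤ 1 := by
    rw [abs_mul]
    have h1 : |t| ≤ T := abs_le.2 ht
    have h2 : |v| ≤ 1 / T := abs_le.2 ⟨hv.1, hv.2.le.trans (by positivity)⟩
    calc |t| * |v| ≤ T * (1 / T) := by gcongr
      _ = 1 := by field_simp
  rw [← Complex.ofReal_neg, Complex.exp_ofReal_mul_I_re, Real.cos_neg]
  have := Real.one_sub_sq_div_two_le_cos (x := t * v)
  have h2 : (t * v) ^ 2 ≤ 1 := by
    rw [← sq_abs]; exact pow_le_one₀ (abs_nonneg _) h1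
  linarith

open MeasureTheory in
theorem gallagher_lemma :
    ∃ C : ℝ, 0 < C ∧ ∀ (a : ℕ → ℂ) (T : ℝ), 1 ≤ T → a 0 = 0 →
      Summable (fun n : ℕ => ‖a n‖) →
      ∫ t in Set.Icc (-T) T, ‖∑' n : ℕ, a n * (n : ℂ) ^ (-(t : ℂ) * Complex.I)‖ ^ 2
        ≤ C * T ^ 2 *
          ∫ x in Set.Ioi (0 : ℝ),
            ‖∑' n : ℕ, if x < (n : ℝ) ∧ (n : ℝ) ≤ x * Real.exp (1 / T) then a n else 0‖ ^ 2 / x := by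
  refine ⟨8 * Real.pi, by positivity, ?_⟩
  intro a T hT h0 ha
  have hT0 : 0 < T := by linarith
  set f : ℝ → ℂ := fun u => ∑' n, glTerm a (1 / T) n u with hf
  have hR : ∫ x in Set.Ioi (0 : ℝ),
      ‖∑' n : ℕ, if x < (n : ℝ) ∧ (n : ℝ) ≤ x * Real.exp (1 / T) then a n else 0‖ ^ 2 / x
      = ∫ u, ‖f u‖ ^ 2 := by
    rw [← Real.range_exp, ← Set.image_univ,
      integral_image_eq_integral_abs_deriv_smul MeasurableSet.univ
        (fun x _ => (Real.hasDerivAt_exp x).hasDerivWithinAt) Real.exp_injective.injOn,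
      setIntegral_univ]
    congr 1 with u
    simp_rw [glTerm_eq a h0 (1 / T) _ u]
    have := Real.exp_pos u
    rw [abs_of_pos this, smul_eq_mul, hf]
    field_simp
  obtain ⟨hm, hP⟩ := gl_plancherel f (gl_integrable a _ ha) (gl_memLp a _ ha)
  have hint : Integrable (fun w => ‖𝓕 f w‖ ^ 2) := hm.integrable_norm_pow (by norm_num)
  have hint' : Integrable (fun t : ℝ => 4 * T ^ 2 * ‖𝓕 f (t / (2 * Real.pi))‖ ^ 2) :=
    (hint.comp_div (by positivity : (2 * Real.pi) ≠ 0)).const_mul _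
  rw [hR, ← hP]
  calc ∫ t in Set.Icc (-T) T, ‖∑' n : ℕ, a n * (n : ℂ) ^ (-(t : ℂ) * Complex.I)‖ ^ 2
      ≤ ∫ t in Set.Icc (-T) T, 4 * T ^ 2 * ‖𝓕 f (t / (2 * Real.pi))‖ ^ 2 := by
        refine integral_mono_of_nonneg ?_ hint'.integrableOn ?_
        · filter_upwards with t
          positivity
        · filter_upwards [ae_restrict_mem measurableSet_Icc] with t ht
          rw [hf, gl_fourier a h0 _ ha t, norm_mul]
          have hk := gl_kernel T t hT ht
          set K := ‖∫ v in Set.Ico (-(1 / T)) 0, Complex.exp (-(t * v : ℝ) * Complex.I)‖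
          set S := ‖∑' n : ℕ, a n * (n : ℂ) ^ (-(t : ℂ) * Complex.I)‖
          have h1 : 1 ≤ 2 * T * K := by
            rw [div_le_iff₀ (by positivity)] at hk
            linarith
          have h2 : 1 ≤ (2 * T * K) ^ 2 := one_le_pow₀ h1
          calc S ^ 2 = S ^ 2 * 1 := by ring
            _ ≤ S ^ 2 * (2 * T * K) ^ 2 := by gcongr
            _ = 4 * T ^ 2 * (S * K) ^ 2 := by ring
    _ ≤ ∫ t : ℝ, 4 * T ^ 2 * ‖𝓕 f (t / (2 * Real.pi))‖ ^ 2 :=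
        setIntegral_le_integral hint' (by filter_upwards with t; positivity)
    _ = 8 * Real.pi * T ^ 2 * ∫ w, ‖𝓕 f w‖ ^ 2 := by
        rw [integral_const_mul, Measure.integral_comp_div (fun w => ‖𝓕 f w‖ ^ 2),
          abs_of_pos (by positivity), smul_eq_mul]
        ring
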